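/- arXiv:2107.13215 — 2 statements merged into one kernel-verified Lean document; each statement's English description precedes it below -/
import Mathlib

section
/- Let R be a finite non-nilpotent ring of prime power order p^n. Then there exists a subring S of R such that S + J(R) = R, S has a multiplicative identity, J(S) = pS, and S ∩ J(R) = pS. -/
/-- The Jacobson radical of a not-necessarily-unital ring `R`, defined as the set of
elements of `R` lying in the Jacobson radical of the unitization `ℤ ⊕ R`. -/
def jacobsonSet (R : Type*) [NonUnitalRing R] : Set R :=
  {x | (x : Unitization ℤ R) ∈ (⊥ : Ideal (Unitization ℤ R)).jacobson}
open TensorProduct in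
def SepIdem (k Q : Type*) [CommRing k] [Ring Q] [Algebra k Q] : Prop :=
  ∃ t : Q ⊗[k] Q, LinearMap.mul' k Q t = 1 ∧
    ∀ a : Q, (LinearMap.mulLeft k a).rTensor Q t = (LinearMap.mulRight k a).lTensor Q t

open TensorProduct in
theorem SepIdem.of_field (k K : Type*) [Field k] [Finite k] [Field K] [Algebra k K]
    [Module.Finite k K] : SepIdem k K := by
  have : Algebra.IsSeparable k K := inferInstance
  have : Algebra.FormallyUnramified k K := Algebra.FormallyUnramified.of_isSeparable k K
  obtain ⟨t, ht, h1⟩ := (Algebra.FormallyUnramified.iff_exists_tensorProduct (R := k) (S := K)).1 this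
  refine ⟨t, ?_, ?_⟩
  · rw [← h1]
    have : ∀ t : K ⊗[k] K, LinearMap.mul' k K t = Algebra.TensorProduct.lmul' k t := by
      intro t
      induction t using TensorProduct.induction_on with
      | zero => simp
      | tmul x y => simp
      | add x y hx hy => rw [map_add, map_add, hx, hy]
    exact this t
  · intro a
    have h := ht a
    rw [sub_mul, sub_eq_zero] at h
    have e1 : ∀ t : K ⊗[k] K, (LinearMap.mulLeft k a).rTensor K t = (a ⊗ₜ[k] (1:K)) * t := by
      intro t
      induction t using TensorProduct.induction_on with
      | zero => simp
      | tmul x y => simp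
      | add x y hx hy => rw [map_add, hx, hy, mul_add]
    have e2 : ∀ t : K ⊗[k] K, (LinearMap.mulRight k a).lTensor K t = ((1:K) ⊗ₜ[k] a) * t := by
      intro t
      induction t using TensorProduct.induction_on with
      | zero => simp
      | tmul x y => simp [mul_comm]
      | add x y hx hy => rw [map_add, hx, hy, mul_add]
    rw [e1, e2, h]

open TensorProduct in
theorem SepIdem.of_equiv {k Q Q' : Type*} [CommRing k] [Ring Q] [Algebra k Q] [Ring Q']
    [Algebra k Q'] (e : Q ≃ₐ[k] Q') (h : SepIdem k Q) : SepIdem k Q' := by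
  obtain ⟨t, h1, h2⟩ := h
  refine ⟨TensorProduct.map e.toLinearMap e.toLinearMap t, ?_, ?_⟩
  · have : ∀ t, LinearMap.mul' k Q' (TensorProduct.map e.toLinearMap e.toLinearMap t)
        = e (LinearMap.mul' k Q t) := by
      intro t
      induction t using TensorProduct.induction_on with
      | zero => simp
      | tmul x y => simp
      | add x y hx hy => simp only [map_add, hx, hy]
    rw [this, h1, map_one]
  · intro a
    have e1 : ∀ t, (LinearMap.mulLeft k a).rTensor Q' (TensorProduct.map e.toLinearMap e.toLinearMap t)
        = TensorProduct.map e.toLinearMap e.toLinearMap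
          ((LinearMap.mulLeft k (e.symm a)).rTensor Q t) := by
      intro t
      induction t using TensorProduct.induction_on with
      | zero => simp
      | tmul x y => simp
      | add x y hx hy => simp only [map_add, hx, hy]
    have e2 : ∀ t, (LinearMap.mulRight k a).lTensor Q' (TensorProduct.map e.toLinearMap e.toLinearMap t)
        = TensorProduct.map e.toLinearMap e.toLinearMap
          ((LinearMap.mulRight k (e.symm a)).lTensor Q t) := by
      intro t
      induction t using TensorProduct.induction_on with
      | zero => simp
      | tmul x y => simp
      | add x y hx hy => simp only [map_add, hx, hy]
    rw [e1, e2, h2]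

open TensorProduct in
theorem SepIdem.pi {k ι : Type*} [CommRing k] [Fintype ι] [DecidableEq ι] (Q : ι → Type*)
    [∀ i, Ring (Q i)] [∀ i, Algebra k (Q i)] (h : ∀ i, SepIdem k (Q i)) :
    SepIdem k (∀ i, Q i) := by
  choose t h1 h2 using h
  let s : ∀ i, Q i →ₗ[k] (∀ i, Q i) := fun i => LinearMap.single k Q i
  refine ⟨∑ i, TensorProduct.map (s i) (s i) (t i), ?_, ?_⟩
  · have : ∀ i t, LinearMap.mul' k (∀ i, Q i) (TensorProduct.map (s i) (s i) t)
        = s i (LinearMap.mul' k (Q i) t) := by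
      intro i t
      induction t using TensorProduct.induction_on with
      | zero => simp
      | tmul x y => simp [s, Pi.single_mul]
      | add x y hx hy => simp only [map_add, hx, hy]
    simp only [map_sum, this, h1, s]
    exact Finset.univ_sum_single (1 : ∀ i, Q i)
  · intro a
    have e1 : ∀ i t, (LinearMap.mulLeft k a).rTensor _ (TensorProduct.map (s i) (s i) t)
        = TensorProduct.map (s i) (s i) ((LinearMap.mulLeft k (a i)).rTensor _ t) := by
      intro i t
      induction t using TensorProduct.induction_on with
      | zero => simp
      | tmul x y =>
        have : a * Pi.single i x = Pi.single i (a i * x) := by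
          ext j; by_cases hj : j = i
          · subst hj; simp
          · simp [hj]
        simp [s, this]
      | add x y hx hy => simp only [map_add, hx, hy]
    have e2 : ∀ i t, (LinearMap.mulRight k a).lTensor _ (TensorProduct.map (s i) (s i) t)
        = TensorProduct.map (s i) (s i) ((LinearMap.mulRight k (a i)).lTensor _ t) := by
      intro i t
      induction t using TensorProduct.induction_on with
      | zero => simp
      | tmul x y =>
        have : Pi.single i y * a = Pi.single i (y * a i) := by
          ext j; by_cases hj : j = i
          · subst hj; simp
          · simp [hj]
        simp [s, this]
      | add x y hx hy => simp only [map_add, hx, hy]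
    simp only [map_sum, e1, e2, h2]

open TensorProduct in
theorem SepIdem.matrix {k K n : Type*} [CommRing k] [Fintype n] [DecidableEq n] [Ring K]
    [Algebra k K] (i0 : n) (h : SepIdem k K) : SepIdem k (Matrix n n K) := by
  obtain ⟨t, h1, h2⟩ := h
  let s : n → n → (K →ₗ[k] Matrix n n K) := fun i j => Matrix.singleLinearMap k i j
  have hs : ∀ i j c, s i j c = Matrix.single i j c := fun i j c => rfl
  refine ⟨∑ i, TensorProduct.map (s i i0) (s i0 i) t, ?_, ?_⟩
  · have : ∀ i t, LinearMap.mul' k (Matrix n n K) (TensorProduct.map (s i i0) (s i0 i) t)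
        = s i i (LinearMap.mul' k K t) := by
      intro i t
      induction t using TensorProduct.induction_on with
      | zero => simp
      | tmul x y => simp [hs]
      | add x y hx hy => simp only [map_add, hx, hy]
    simp only [map_sum, this, h1, hs]
    ext i j
    by_cases hij : i = j
    · subst hij
      simp [Matrix.sum_apply, Matrix.single_apply]
    · have : ∀ x : n, ¬ (x = i ∧ x = j) := fun x hx => hij (hx.1.symm.trans hx.2)
      simp [Matrix.sum_apply, hij, this]
  · have key : ∀ u v c, (LinearMap.mulLeft k (Matrix.single u v c : Matrix n n K)).rTensor _
          (∑ i, TensorProduct.map (s i i0) (s i0 i) t) =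
        (LinearMap.mulRight k (Matrix.single u v c : Matrix n n K)).lTensor _
          (∑ i, TensorProduct.map (s i i0) (s i0 i) t) := by
      intro u v c
      have e1 : ∀ i t, (LinearMap.mulLeft k (Matrix.single u v c : Matrix n n K)).rTensor _
          (TensorProduct.map (s i i0) (s i0 i) t) =
          if v = i then TensorProduct.map (s u i0) (s i0 v) ((LinearMap.mulLeft k c).rTensor _ t)
          else 0 := by
        intro i t
        induction t using TensorProduct.induction_on with
        | zero => simp
        | tmul x y =>
          by_cases hv : v = i
          · subst hv; simp [hs]
          · simp [hs, hv]
        | add x y hx hy => 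
          simp only [map_add, hx, hy]; split_ifs <;> simp
      have e2 : ∀ i t, (LinearMap.mulRight k (Matrix.single u v c : Matrix n n K)).lTensor _
          (TensorProduct.map (s i i0) (s i0 i) t) =
          if u = i then TensorProduct.map (s u i0) (s i0 v) ((LinearMap.mulRight k c).lTensor _ t)
          else 0 := by
        intro i t
        induction t using TensorProduct.induction_on with
        | zero => simp
        | tmul x y =>
          by_cases hv : u = i
          · subst hv; simp [hs]
          · simp [hs, hv, Ne.symm hv]
        | add x y hx hy => 
          simp only [map_add, hx, hy]; split_ifs <;> simp
      simp only [map_sum, e1, e2, h2]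
      simp
    intro a
    induction a using Matrix.induction_on' with
    | h_zero => simp [LinearMap.rTensor_zero, LinearMap.lTensor_zero]
    | h_add p q hp hq =>
      have a1 : LinearMap.mulLeft k (p + q) = LinearMap.mulLeft k p + LinearMap.mulLeft k q := by
        ext; simp [add_mul]
      have a2 : LinearMap.mulRight k (p + q) = LinearMap.mulRight k p + LinearMap.mulRight k q := by
        ext; simp [mul_add]
      rw [a1, a2, LinearMap.rTensor_add, LinearMap.lTensor_add, LinearMap.add_apply,
        LinearMap.add_apply, hp, hq]
    | h_std_basis u v c => exact key u v c

theorem SepIdem.of_semisimple (p : ℕ) [Fact p.Prime] (Q : Type*) [Ring Q] [Finite Q]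
    [Algebra (ZMod p) Q] [IsSemisimpleRing Q] : SepIdem (ZMod p) Q := by
  have : Module.Finite (ZMod p) Q := inferInstance
  obtain ⟨n, D, d, _, _, _, hd, ⟨e⟩⟩ :=
    IsSemisimpleRing.exists_algEquiv_pi_matrix_divisionRing_finite (ZMod p) Q
  refine SepIdem.of_equiv e.symm (SepIdem.pi _ fun i => SepIdem.matrix (0 : Fin (d i)) ?_)
  have : Finite (D i) := Module.finite_of_finite (ZMod p)
  let _ : Field (D i) := littleWedderburn (D i)
  exact SepIdem.of_field (ZMod p) (D i)

open TensorProduct in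
/-- Square-zero extensions of separable algebras over a field split. -/
theorem SepIdem.split {k A Q : Type*} [Field k] [Ring A] [Ring Q] [Algebra k A] [Algebra k Q]
    (h : SepIdem k Q) (π : A →ₐ[k] Q) (hπ : Function.Surjective π)
    (hN : ∀ a b, π a = 0 → π b = 0 → a * b = 0) :
    ∃ g : Q →+* A, ∀ q, π (g q) = q := by
  obtain ⟨t, h1, h2⟩ := h
  obtain ⟨σ, hσ⟩ := π.toLinearMap.exists_rightInverse_of_surjective (LinearMap.range_eq_top.2 hπ)
  have hs : ∀ q, π (σ q) = q := fun q => LinearMap.congr_fun hσ q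
  obtain ⟨s, hts⟩ := TensorProduct.exists_finset t
  have h1' : ∑ i ∈ s, i.1 * i.2 = 1 := by
    rw [← h1, hts]; simp
  have h2' : ∀ (a : Q) (β : Q →ₗ[k] Q →ₗ[k] A),
      ∑ i ∈ s, β (a * i.1) i.2 = ∑ i ∈ s, β i.1 (i.2 * a) := by
    intro a β
    have := congrArg (TensorProduct.lift β) (h2 a)
    rw [hts] at this
    simpa using this
  let f : Q → Q → A := fun a b => σ a * σ b - σ (a * b)
  have hf : ∀ a b, π (f a b) = 0 := fun a b => by simp [f, hs]
  let h : Q → A := fun a => ∑ i ∈ s, f a i.1 * σ i.2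
  have hh : ∀ a, π (h a) = 0 := fun a => by simp [h, hf]
  have hadd : ∀ a b, h (a + b) = h a + h b := by
    intro a b
    simp only [h, ← Finset.sum_add_distrib, f, map_add, add_mul]
    exact Finset.sum_congr rfl fun i _ => by noncomm_ring
  have hm : ∀ a b, σ a * h b + h a * σ b - h (a * b) = f a b := by
    intro a b
    let β : Q →ₗ[k] Q →ₗ[k] A :=
      ((LinearMap.mul k A).compl₂ σ).comp
        ((LinearMap.mulLeft k (σ a)).comp σ - σ.comp (LinearMap.mulLeft k a))
    have hβ : ∀ x y, β x y = f a x * σ y := fun x y => by simp [β, f, sub_mul]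
    have e1 : h a * σ b = ∑ i ∈ s, f a (b * i.1) * σ i.2 := by
      have := h2' b β
      simp only [hβ] at this
      rw [this, Finset.sum_mul]
      refine Finset.sum_congr rfl fun i _ => ?_
      have := hN _ _ (hf a i.1) (hf i.2 b)
      simp only [f] at this ⊢
      rw [mul_sub, sub_eq_zero] at this
      rw [mul_assoc, this]
    have e2 : f a b * ∑ i ∈ s, σ i.1 * σ i.2 = f a b := by
      have : π (∑ i ∈ s, σ i.1 * σ i.2 - 1) = 0 := by simp [hs, h1']
      have := hN _ _ (hf a b) this
      rwa [mul_sub, sub_eq_zero, mul_one] at this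
    rw [e1, ← e2]
    simp only [h, Finset.mul_sum, ← Finset.sum_add_distrib, ← Finset.sum_sub_distrib]
    refine Finset.sum_congr rfl fun i _ => ?_
    simp only [f, mul_assoc a b]
    noncomm_ring
  let g : Q → A := fun a => σ a - h a
  have gadd : ∀ a b, g (a + b) = g a + g b := fun a b => by
    simp only [g, hadd, map_add]; abel
  have gπ : ∀ a, π (g a) = a := fun a => by simp [g, hs, hh]
  have gmul : ∀ a b, g (a * b) = g a * g b := by
    intro a b
    have e := hm a b
    have e' := hN _ _ (hh a) (hh b)
    have : (σ a - h a) * (σ b - h b) = σ a * σ b - (σ a * h b + h a * σ b) + h a * h b := by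
      noncomm_ring
    simp only [g]
    rw [this, e', ← sub_eq_zero]
    have e2 : σ a * h b + h a * σ b = h (a * b) + f a b := by rw [← e]; abel
    rw [e2]
    simp only [f]; abel
  have gone : g 1 = 1 := by
    have e : g 1 * g 1 = g 1 := by rw [← gmul, one_mul]
    have := hN (1 - g 1) (1 - g 1) (by simp [gπ]) (by simp [gπ])
    have e2 : (1 - g 1) * (1 - g 1) = 1 - g 1 - g 1 + g 1 * g 1 := by noncomm_ring
    rw [e2, e] at this
    have : 1 - g 1 = 0 := by rw [← this]; abel
    exact (sub_eq_zero.1 this).symm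
  exact ⟨RingHom.mk' ⟨⟨g, gone⟩, gmul⟩ gadd, gπ⟩

theorem exists_idem_pow {M : Type*} [Monoid M] (x : M)
    (hfin : (Set.range fun k : ℕ => x ^ (k + 1)).Finite) :
    ∃ m : ℕ, x ^ (m + 1) * x ^ (m + 1) = x ^ (m + 1) := by
  have hni : ¬ Function.Injective (fun k : ℕ => x ^ (k + 1)) := fun hinj =>
    Set.infinite_range_of_injective hinj hfin
  have : ∃ a d : ℕ, x ^ (a + 1) = x ^ (a + 1 + (d + 1)) := by
    simp only [Function.Injective, not_forall] at hni
    obtain ⟨a, b, hab, hne⟩ := hni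
    rcases Nat.lt_or_gt_of_ne hne with h | h
    · refine ⟨a, b - a - 1, ?_⟩
      rw [show a + 1 + (b - a - 1 + 1) = b + 1 by omega]; exact hab
    · refine ⟨b, a - b - 1, ?_⟩
      rw [show b + 1 + (a - b - 1 + 1) = a + 1 by omega]; exact hab.symm
  obtain ⟨a, d, h⟩ := this
  have h1 : ∀ t, x ^ (a + 1) = x ^ (a + 1 + t * (d + 1)) := by
    intro t
    induction t with
    | zero => simp
    | succ t ih =>
      rw [Nat.succ_mul, ← add_assoc, pow_add x (a + 1 + t * (d + 1)), ← ih, ← pow_add, ← h]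
  refine ⟨(a + 1) * (d + 1) - 1, ?_⟩
  have hpos : (a + 1) * (d + 1) - 1 + 1 = (a + 1) + (a + 1) * d := by
    have : (a + 1) * (d + 1) = (a + 1) + (a + 1) * d := by ring
    omega
  rw [hpos]
  have := h1 (a + 1)
  calc x ^ (a + 1 + (a + 1) * d) * x ^ (a + 1 + (a + 1) * d)
      = x ^ (a + 1 + (a + 1) * (d + 1)) * x ^ ((a + 1) * d) := by
        rw [← pow_add, ← pow_add]; congr 1; ring
    _ = x ^ (a + 1 + (a + 1) * d) := by rw [← this, ← pow_add]

theorem mem_jac_of_nil {A : Type*} [Ring A] {x : A} (h : ∀ y, IsNilpotent (y * x)) :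
    x ∈ (⊥ : Ideal A).jacobson := by
  rw [Ideal.mem_jacobson_iff]
  intro y
  obtain ⟨u, hu⟩ := (h y).isUnit_add_one
  refine ⟨((u⁻¹ : Aˣ) : A), ?_⟩
  have : ((u⁻¹ : Aˣ) : A) * (y * x + 1) = 1 := by rw [← hu]; simp
  rw [mul_add, mul_one, ← mul_assoc] at this
  rw [this, sub_self]; exact Ideal.zero_mem _

theorem nil_of_mem_jac {A : Type*} [Ring A] {x : A} (h : x ∈ (⊥ : Ideal A).jacobson)
    (hfin : (Set.range fun k : ℕ => x ^ (k + 1)).Finite) : IsNilpotent x := by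
  obtain ⟨m, hm⟩ := exists_idem_pow x hfin
  refine ⟨m + 1, ?_⟩
  have hmem : x ^ (m + 1) ∈ (⊥ : Ideal A).jacobson := by
    rw [pow_succ]; exact Ideal.mul_mem_left _ _ h
  generalize x ^ (m + 1) = e at hm hmem
  obtain ⟨z, hz⟩ := Ideal.mem_jacobson_iff.1 hmem (-1)
  have hz : z * -1 * e + z - 1 = 0 := by simpa using hz
  calc e = z * e - z * (e * e) - (z * -1 * e + z - 1) * e := by noncomm_ring
    _ = 0 := by rw [hm, hz]; simp

theorem mem_jac_iff_nil {A : Type*} [Ring A] [Finite A] {x : A} :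
    x ∈ Ring.jacobson A ↔ ∀ y, IsNilpotent (y * x) := by
  rw [← Ideal.jacobson_bot]
  exact ⟨fun h y => nil_of_mem_jac (Ideal.mul_mem_left _ y h) (Set.toFinite _), mem_jac_of_nil⟩

theorem zmod_algebra {p : ℕ} {A : Type*} [Ring A] (h : (p : A) = 0) :
    Nonempty (Algebra (ZMod p) A) := by
  let _ : Module (ZMod p) A := AddCommGroup.zmodModule (fun x => by simp [h])
  exact ⟨Algebra.ofModule
    (fun r x y => (ZMod.map_smul (AddMonoidHom.mulRight y) r x))
    (fun r x y => (ZMod.map_smul (AddMonoidHom.mulLeft x) r y))⟩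

theorem unital_key {p n : ℕ} (hp : p.Prime) {S : Type*} [Ring S] [Finite S]
    (hpn : (p : S) ^ n = 0)
    (hmin : ∀ T : Subring S, (∀ s, ∃ t ∈ T, s - t ∈ Ring.jacobson S) → T = ⊤) (x : S) :
    x ∈ Ring.jacobson S ↔ ∃ s, x = p • s := by
  have hsub : ∀ s : S, p • s ∈ Ring.jacobson S := by
    intro s
    rw [mem_jac_iff_nil]
    intro y
    refine ⟨n, ?_⟩
    rw [nsmul_eq_mul, ← mul_assoc, ← (Nat.cast_commute p y).eq, mul_assoc,
      (Nat.cast_commute p _).mul_pow, hpn, zero_mul]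
  have hfact : Fact p.Prime := ⟨hp⟩
  refine ⟨fun hx => ?_, fun ⟨s, hs⟩ => hs ▸ hsub s⟩
  let J := Ring.jacobson S
  let P : Ideal S := Ideal.span {(p : S)}
  have hP2 : P.IsTwoSided := by
    refine ⟨fun {a} b ha => ?_⟩
    obtain ⟨c, rfl⟩ := Ideal.mem_span_singleton'.1 ha
    rw [mul_assoc, (Nat.cast_commute p b).eq, ← mul_assoc]
    exact Ideal.mul_mem_left _ _ (Ideal.mem_span_singleton_self _)
  let I : Ideal S := P ⊔ J * J
  have hI2 : I.IsTwoSided := by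
    refine ⟨fun {a} b ha => ?_⟩
    obtain ⟨c, hc, d, hd, rfl⟩ := Submodule.mem_sup.1 ha
    rw [add_mul]
    exact add_mem (Submodule.mem_sup_left (Ideal.mul_mem_right _ _ hc))
      (Submodule.mem_sup_right (Ideal.mul_mem_right _ _ hd))
  have hPJ : P ≤ J := by
    refine (Ideal.span_singleton_le_iff_mem _).2 ?_
    simpa using hsub 1
  have hIJ : I ≤ J := sup_le hPJ Ideal.mul_le_left
  have hpI : ((p : ℕ) : S ⧸ I) = 0 := by
    have : Ideal.Quotient.mk I (p : S) = 0 := Ideal.Quotient.eq_zero_iff_mem.2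
      (Submodule.mem_sup_left (Ideal.mem_span_singleton_self _))
    simpa using this
  have hpJ : ((p : ℕ) : S ⧸ J) = 0 := by
    have : Ideal.Quotient.mk J (p : S) = 0 := Ideal.Quotient.eq_zero_iff_mem.2
      (hPJ (Ideal.mem_span_singleton_self _))
    simpa using this
  obtain ⟨alg1⟩ := zmod_algebra hpI
  obtain ⟨alg2⟩ := zmod_algebra hpJ
  have : IsSemisimpleRing (S ⧸ J) := IsSemiprimaryRing.isSemisimpleRing
  have : Finite (S ⧸ J) := Finite.of_surjective _ Ideal.Quotient.mk_surjective
  let π0 : S ⧸ I →+* S ⧸ J := Ideal.Quotient.factor hIJ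
  let π : S ⧸ I →ₐ[ZMod p] S ⧸ J :=
    { π0 with
      commutes' := fun r => RingHom.congr_fun
        (Subsingleton.elim (π0.comp (algebraMap (ZMod p) (S ⧸ I)))
          (algebraMap (ZMod p) (S ⧸ J))) r }
  have hπ : ∀ s, π (Ideal.Quotient.mk I s) = Ideal.Quotient.mk J s := fun s => rfl
  obtain ⟨g, hg⟩ := (SepIdem.of_semisimple p (S ⧸ J)).split π
    (fun q => by
      obtain ⟨s, rfl⟩ := Ideal.Quotient.mk_surjective q
      exact ⟨Ideal.Quotient.mk I s, hπ s⟩)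
    (fun a b ha hb => by
      obtain ⟨a, rfl⟩ := Ideal.Quotient.mk_surjective a
      obtain ⟨b, rfl⟩ := Ideal.Quotient.mk_surjective b
      rw [hπ, Ideal.Quotient.eq_zero_iff_mem] at ha hb
      rw [← map_mul, Ideal.Quotient.eq_zero_iff_mem]
      exact Submodule.mem_sup_right (Ideal.mul_mem_mul ha hb))
  have hT := hmin (g.range.comap (Ideal.Quotient.mk I)) (fun s => by
    obtain ⟨t, ht⟩ := Ideal.Quotient.mk_surjective (g (Ideal.Quotient.mk J s))
    refine ⟨t, ⟨_, ht.symm⟩, ?_⟩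
    have h1 := hg (Ideal.Quotient.mk J s)
    rw [← ht, hπ] at h1
    exact Ideal.Quotient.eq.1 h1.symm)
  have hJI : J ≤ I := by
    intro j hj
    have : j ∈ g.range.comap (Ideal.Quotient.mk I) := by rw [hT]; trivial
    obtain ⟨q, hq⟩ := this
    have h1 := hg q
    rw [hq, hπ, Ideal.Quotient.eq_zero_iff_mem.2 hj] at h1
    rw [← h1, map_zero] at hq
    exact Ideal.Quotient.eq_zero_iff_mem.1 hq.symm
  have hpow : ∀ k, J ≤ P ⊔ J ^ (k + 1) := by
    intro k
    induction k with
    | zero => rw [zero_add, Submodule.pow_one]; exact le_sup_right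
    | succ k ih =>
      refine hJI.trans (sup_le le_sup_left ?_)
      calc J * J ≤ J * (P ⊔ J ^ (k + 1)) := Ideal.mul_mono_right ih
        _ = J * P ⊔ J * J ^ (k + 1) := Ideal.mul_sup _ _ _
        _ ≤ P ⊔ J ^ (k + 1 + 1) := sup_le_sup Ideal.mul_le_right
            (Ideal.IsTwoSided.pow_succ (I := J) (k + 1)).ge
  obtain ⟨k, hk⟩ := (IsSemiprimaryRing.isNilpotent : IsNilpotent (Ring.jacobson S))
  have hJP : J ≤ P := by
    refine (hpow k).trans (sup_le le_rfl ?_)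
    rw [Ideal.IsTwoSided.pow_succ (I := J) k, show J ^ k = ⊥ from hk, Ideal.mul_bot]
    exact bot_le
  obtain ⟨c, hc⟩ := Ideal.mem_span_singleton'.1 (hJP hx)
  exact ⟨c, by rw [← hc, nsmul_eq_mul, (Nat.cast_commute p c).eq]⟩

section NonUnitalPart

variable {R : Type*} [NonUnitalRing R]

theorem mul_inr_eq (y : Unitization ℤ R) (x : R) :
    y * (x : Unitization ℤ R) = ((y.fst • x + y.snd * x : R) : Unitization ℤ R) := by
  refine Unitization.ext ?_ ?_
  · simp only [Unitization.fst_mul, Unitization.fst_inr, mul_zero]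
  · simp only [Unitization.snd_mul, Unitization.fst_inr, Unitization.snd_inr, zero_smul, add_zero]

theorem inr_pow_mem_range (x : R) (k : ℕ) :
    ∃ r : R, (x : Unitization ℤ R) ^ (k + 1) = (r : Unitization ℤ R) := by
  rw [pow_succ, mul_inr_eq]; exact ⟨_, rfl⟩

theorem inr_pow_finite [Finite R] (x : R) :
    (Set.range fun k : ℕ => (x : Unitization ℤ R) ^ (k + 1)).Finite := by
  refine (Set.finite_range (fun r : R => (r : Unitization ℤ R))).subset ?_
  rintro _ ⟨k, rfl⟩
  obtain ⟨r, hr⟩ := inr_pow_mem_range x k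
  exact ⟨r, hr.symm⟩

theorem jac_nil [Finite R] {x : R} (hx : x ∈ jacobsonSet R) :
    IsNilpotent (x : Unitization ℤ R) :=
  nil_of_mem_jac hx (inr_pow_finite x)

theorem nil_of_pow_mem [Finite R] {x : R} {k : ℕ}
    (h : (x : Unitization ℤ R) ^ (k + 1) ∈ (⊥ : Ideal (Unitization ℤ R)).jacobson) :
    IsNilpotent (x : Unitization ℤ R) := by
  obtain ⟨r, hr⟩ := inr_pow_mem_range x k
  rw [hr] at h
  have := jac_nil (x := r) h
  rw [← hr] at this
  obtain ⟨m, hm⟩ := this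
  exact ⟨(k + 1) * m, by rw [pow_mul]; exact hm⟩

theorem jac_add {x y : R} (hx : x ∈ jacobsonSet R) (hy : y ∈ jacobsonSet R) :
    x + y ∈ jacobsonSet R := by
  have hx : (x : Unitization ℤ R) ∈ (⊥ : Ideal (Unitization ℤ R)).jacobson := hx
  have hy : (y : Unitization ℤ R) ∈ (⊥ : Ideal (Unitization ℤ R)).jacobson := hy
  change ((x + y : R) : Unitization ℤ R) ∈ (⊥ : Ideal (Unitization ℤ R)).jacobson
  rw [Unitization.inr_add]
  exact Ideal.add_mem _ hx hy

theorem jac_mul_left {x : R} (y : R) (hx : x ∈ jacobsonSet R) : y * x ∈ jacobsonSet R := by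
  have hx : (x : Unitization ℤ R) ∈ (⊥ : Ideal (Unitization ℤ R)).jacobson := hx
  change ((y * x : R) : Unitization ℤ R) ∈ (⊥ : Ideal (Unitization ℤ R)).jacobson
  rw [Unitization.inr_mul]
  exact Ideal.mul_mem_left _ _ hx

theorem jac_mul_right {x : R} (y : R) (hx : x ∈ jacobsonSet R) : x * y ∈ jacobsonSet R := by
  have := Ideal.mul_mem_right (y : Unitization ℤ R) (⊥ : Ideal (Unitization ℤ R)).jacobson hx
  rwa [← Unitization.inr_mul] at this

theorem exists_idem_mod_jac [Finite R] :
    ∃ e : R, e * e = e ∧ ∀ x, x - x * e ∈ jacobsonSet R ∧ x - e * x ∈ jacobsonSet R := by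
  have : Nonempty {e : R // e * e = e} := ⟨⟨0, by simp⟩⟩
  obtain ⟨⟨e, he⟩, hmax⟩ := Finite.exists_max
    (fun e : {e : R // e * e = e} => Set.ncard {x : R | x * e.1 = x})
  have hK : ∀ f : R, f * f = f → f * e = 0 → f = 0 := by
    intro f hf hfe
    by_contra hf0
    have h1 : (e + f - e * f) * e = e := by
      rw [sub_mul, add_mul, mul_assoc, hfe, he]; simp
    have h2 : (e + f - e * f) * f = f := by
      rw [sub_mul, add_mul, mul_assoc, hf]; simp
    have hidem : (e + f - e * f) * (e + f - e * f) = e + f - e * f := by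
      rw [mul_sub, mul_add, h1, h2, ← mul_assoc, h1]
    have h3 : e * (e + f - e * f) = e := by
      rw [mul_sub, mul_add, ← mul_assoc, he]; simp
    have h4 : f * (e + f - e * f) = f := by
      rw [mul_sub, mul_add, ← mul_assoc, hfe, hf]; simp
    have := hmax ⟨_, hidem⟩
    refine absurd this (not_le.2 (Set.ncard_lt_ncard ?_ (Set.toFinite _)))
    refine (Set.ssubset_iff_of_subset ?_).2 ⟨f, h4, ?_⟩
    · intro x (hx : x * e = x)
      change x * (e + f - e * f) = x
      calc x * (e + f - e * f) = x * (e * (e + f - e * f)) := by rw [← mul_assoc, hx]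
        _ = x := by rw [h3, hx]
    · intro (h : f * e = f)
      exact hf0 (h.symm.trans hfe)
  have hKnil : ∀ x : R, x * e = 0 → IsNilpotent (x : Unitization ℤ R) := by
    intro x hx
    obtain ⟨m, hm⟩ := exists_idem_pow _ (inr_pow_finite x)
    refine ⟨m + 1, ?_⟩
    obtain ⟨r, hr⟩ := inr_pow_mem_range x m
    have hre : r * e = 0 := by
      have : (r : Unitization ℤ R) * (e : Unitization ℤ R) = 0 := by
        rw [← hr, pow_succ, mul_assoc, ← Unitization.inr_mul, hx]; simp
      rw [← Unitization.inr_mul] at this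
      exact Unitization.inr_injective (this.trans (Unitization.inr_zero _).symm)
    rw [hr, ← Unitization.inr_mul] at hm
    rw [hr, hK r (Unitization.inr_injective hm) hre, Unitization.inr_zero]
  have hKJ : ∀ x : R, x * e = 0 → x ∈ jacobsonSet R := by
    intro x hx
    refine mem_jac_of_nil fun y => ?_
    rw [mul_inr_eq]
    refine hKnil _ ?_
    rw [add_mul, smul_mul_assoc, mul_assoc, hx]; simp
  have hleft : ∀ x, x - x * e ∈ jacobsonSet R := fun x => hKJ _ (by
    rw [sub_mul, mul_assoc, he, sub_self])
  refine ⟨e, he, fun x => ⟨hleft x, ?_⟩⟩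
  have hz : ∀ z, z * (x - e * x) ∈ jacobsonSet R := by
    intro z
    have : z * (x - e * x) = (z - z * e) * x := by noncomm_ring
    rw [this]
    exact jac_mul_right _ (hleft z)
  generalize x - e * x = w at hz
  refine mem_jac_of_nil fun y => ?_
  rw [mul_inr_eq]
  refine nil_of_pow_mem (k := 1) ?_
  have : (y.fst • w + y.snd * w) * (y.fst • w + y.snd * w) =
      (y.fst • (y.fst • w + y.snd * w) + (y.fst • w + y.snd * w) * y.snd) * w := by
    have h : ∀ v : R, v * (y.fst • w + y.snd * w) = (y.fst • v + v * y.snd) * w := by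
      intro v
      rw [mul_add, add_mul, mul_smul_comm, smul_mul_assoc, mul_assoc]
    exact h _
  rw [show 1 + 1 = 2 from rfl, sq, ← Unitization.inr_mul, this]
  exact hz _

theorem jac_iff_of_inj [Finite R] {S : Type*} [Ring S] [Finite S] (φ : S →ₙ+* R)
    (hφ : Function.Injective φ) (hs : ∀ r, ∃ s, ∃ j ∈ jacobsonSet R, r = φ s + j) (x : S) :
    x ∈ Ring.jacobson S ↔ φ x ∈ jacobsonSet R := by
  have hpow : ∀ (x : S) (k : ℕ), ((φ x : R) : Unitization ℤ R) ^ (k + 1) =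
      ((φ (x ^ (k + 1)) : R) : Unitization ℤ R) := by
    intro x k
    induction k with
    | zero => simp
    | succ k ih => rw [pow_succ, ih, ← Unitization.inr_mul, ← map_mul, ← pow_succ]
  rw [mem_jac_iff_nil]
  constructor
  · intro h
    refine mem_jac_of_nil fun y => ?_
    obtain ⟨s, j, hj, hr⟩ := hs y.snd
    obtain ⟨k, hk⟩ := h ((y.fst : S) + s)
    have hw : ((j * φ x : R) : Unitization ℤ R) ∈ (⊥ : Ideal (Unitization ℤ R)).jacobson :=
      jac_mul_right _ hj
    have e : y.fst • φ x + y.snd * φ x = φ (((y.fst : S) + s) * x) + j * φ x := by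
      rw [hr, add_mul, add_mul, map_add, ← zsmul_eq_mul, map_zsmul, map_mul, add_assoc]
    rw [mul_inr_eq]
    refine nil_of_pow_mem (k := k) ?_
    rw [e, Unitization.inr_add, ← Ideal.Quotient.eq_zero_iff_mem, map_pow, map_add,
      Ideal.Quotient.eq_zero_iff_mem.2 hw, add_zero, ← map_pow, hpow, pow_succ, hk]
    simp
  · intro h y
    obtain ⟨k, hk⟩ := jac_nil (jac_mul_left (φ y) h)
    refine ⟨k + 1, hφ (Unitization.inr_injective (R := ℤ) ?_)⟩
    rw [← hpow, map_mul, pow_succ, hk]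
    simp

end NonUnitalPart

theorem stmt_5 (p n : ℕ) (hp : p.Prime) (R : Type) [NonUnitalRing R] [Fintype R]
    (hcard : Fintype.card R = p ^ n)
    (hnotnil : ¬ ∃ k : ℕ, 0 < k ∧ ∀ (a : R) (l : List R), l.length + 1 = k →
        l.foldl (· * ·) a = 0) :
    ∃ S : NonUnitalSubring R,
      (∀ r : R, ∃ s ∈ S, ∃ j ∈ jacobsonSet R, r = s + j) ∧
      (∃ e ∈ S, ∀ s ∈ S, e * s = s ∧ s * e = s) ∧
      (jacobsonSet S = {x : S | ∃ s : S, x = p • s}) ∧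
      ({x : R | x ∈ S ∧ x ∈ jacobsonSet R} = {x : R | ∃ s ∈ S, x = p • s}) := by
  obtain ⟨e, he, hej⟩ := exists_idem_mod_jac (R := R)
  let Good : Set (NonUnitalSubring R) := {S | e ∈ S ∧ (∀ s ∈ S, e * s = s ∧ s * e = s) ∧
    ∀ r : R, ∃ s ∈ S, ∃ j ∈ jacobsonSet R, r = s + j}
  let S0 : NonUnitalSubring R :=
    { carrier := {x | e * x = x ∧ x * e = x}
      add_mem' := fun {a b} ha hb => ⟨by rw [mul_add, ha.1, hb.1], by rw [add_mul, ha.2, hb.2]⟩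
      zero_mem' := ⟨by simp, by simp⟩
      neg_mem' := fun {a} ha => ⟨by rw [mul_neg, ha.1], by rw [neg_mul, ha.2]⟩
      mul_mem' := fun {a b} ha hb => ⟨by rw [← mul_assoc, ha.1], by rw [mul_assoc, hb.2]⟩ }
  have hS0 : S0 ∈ Good := by
    refine ⟨⟨he, he⟩, fun s hs => hs, fun r => ⟨e * r * e, ⟨?_, ?_⟩, r - e * r * e, ?_, ?_⟩⟩
    · rw [← mul_assoc, ← mul_assoc, he]
    · rw [mul_assoc, he]
    · have : r - e * r * e = (r - r * e) + (r - e * r) * e := by rw [sub_mul]; abel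
      rw [this]
      exact jac_add (hej r).1 (jac_mul_right _ (hej r).2)
    · abel
  have hfinS : Finite (NonUnitalSubring R) :=
    Finite.of_injective (fun S : NonUnitalSubring R => (S : Set R)) SetLike.coe_injective
  obtain ⟨S, ⟨heS, hunit, hsum⟩, hSmin⟩ := (Set.toFinite Good).exists_minimal ⟨S0, hS0⟩
  let _ : Ring S :=
    { (inferInstance : NonUnitalRing S) with
      one := ⟨e, heS⟩
      one_mul := fun s => Subtype.ext (hunit s.1 s.2).1
      mul_one := fun s => Subtype.ext (hunit s.1 s.2).2 }
  let φ : S →ₙ+* R := NonUnitalSubringClass.subtype S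
  have hφ : Function.Injective φ := Subtype.val_injective
  have hsum' : ∀ r, ∃ s, ∃ j ∈ jacobsonSet R, r = φ s + j := fun r => by
    obtain ⟨s, hs, j, hj, h⟩ := hsum r
    exact ⟨⟨s, hs⟩, j, hj, h⟩
  have hJ1 : ∀ x : S, x ∈ Ring.jacobson S ↔ (x : R) ∈ jacobsonSet R :=
    jac_iff_of_inj φ hφ hsum'
  have hJ2 : ∀ x : S, x ∈ Ring.jacobson S ↔ x ∈ jacobsonSet S :=
    jac_iff_of_inj (NonUnitalRingHom.id S) Function.injective_id
      (fun r => ⟨r, 0, by simp [jacobsonSet], by simp⟩)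
  have hpn : (p : S) ^ n = 0 := by
    have : (p ^ n) • (1 : S) = 0 := by
      refine Subtype.ext ?_
      change ((p ^ n) • (1 : S) : S).1 = 0
      have h : φ ((p ^ n) • (1 : S)) = (p ^ n) • φ 1 := map_nsmul φ _ _
      rw [← hcard, card_nsmul_eq_zero] at h
      rw [← hcard]
      exact h
    rw [nsmul_eq_mul, mul_one] at this
    exact_mod_cast this
  have key := unital_key hp hpn (fun T hT => by
    have hle : T.toNonUnitalSubring.map φ ≤ S := by
      rintro _ ⟨t, _, rfl⟩
      exact t.2
    have hgood : T.toNonUnitalSubring.map φ ∈ Good := by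
      refine ⟨⟨1, T.one_mem, rfl⟩, fun s hs => hunit s (hle hs), fun r => ?_⟩
      obtain ⟨s, j, hj, h⟩ := hsum' r
      obtain ⟨t, ht, hst⟩ := hT s
      refine ⟨φ t, ⟨t, ht, rfl⟩, φ (s - t) + j, jac_add ((hJ1 _).1 hst) hj, ?_⟩
      rw [h, map_sub]; abel
    have hge := hSmin hgood hle
    refine eq_top_iff.2 fun s _ => ?_
    obtain ⟨t, ht, hts⟩ := hge s.2
    rw [← hφ hts]; exact ht)
  refine ⟨S, hsum, ⟨e, heS, hunit⟩, ?_, ?_⟩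
  · ext x
    exact (hJ2 x).symm.trans (key x)
  · ext x
    constructor
    · rintro ⟨hxS, hxJ⟩
      obtain ⟨s, hs⟩ := (key ⟨x, hxS⟩).1 ((hJ1 _).2 hxJ)
      refine ⟨s, s.2, ?_⟩
      have := congrArg φ hs
      rw [map_nsmul] at this
      exact this
    · rintro ⟨s, hs, rfl⟩
      refine ⟨nsmul_mem hs p, ?_⟩
      have := (hJ1 _).1 ((key (p • (⟨s, hs⟩ : S))).2 ⟨_, rfl⟩)
      have h : φ (p • (⟨s, hs⟩ : S)) = p • s := map_nsmul φ _ _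
      rw [← h]; exact this
end

section
/- Let S be a finite ring with identity of prime power order p^m. Then S is isomorphic to a finite direct sum of full matrix rings over Galois rings if and only if J(S) = pS. -/
open Polynomial

theorem gr_map (p k : ℕ) (hk : 0 < k) (f : (ZMod (p^k))[X]) :
   ∃ π : (ZMod (p^k))[X] ⧸ Ideal.span {f} →+* (ZMod p)[X] ⧸ Ideal.span {f.map (ZMod.castHom (dvd_pow_self p hk.ne') (ZMod p))},
    Function.Surjective π ∧ ∀ x, π x = 0 ↔ ∃ y, x = p • y := by
  set c := ZMod.castHom (dvd_pow_self p hk.ne') (ZMod p) with hc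
  have hcs : Function.Surjective c := ZMod.castHom_surjective _
  refine ⟨Ideal.quotientMap _ (Polynomial.mapRingHom c) ?_, ?_, ?_⟩
  · rw [Ideal.span_le, Set.singleton_subset_iff]
    exact Ideal.mem_span_singleton_self _
  · exact Ideal.quotientMap_surjective (Polynomial.map_surjective _ hcs)
  · intro x
    obtain ⟨g, rfl⟩ := Ideal.Quotient.mk_surjective x
    rw [Ideal.quotientMap_mk, Ideal.Quotient.eq_zero_iff_mem, Ideal.mem_span_singleton]
    constructor
    · rintro ⟨h, hh⟩
      obtain ⟨h', rfl⟩ := Polynomial.map_surjective c hcs h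
      rw [Polynomial.coe_mapRingHom, ← Polynomial.map_mul] at hh
      have h0 : (g - f * h').map c = 0 := by rw [Polynomial.map_sub, hh, sub_self]
      have h1 : C (p : ZMod (p^k)) ∣ (g - f * h') := by
        rw [Polynomial.C_dvd_iff_dvd_coeff]
        intro i
        have h2 : c ((g - f * h').coeff i) = 0 := by rw [← Polynomial.coeff_map, h0, coeff_zero]
        generalize (g - f * h').coeff i = z at h2
        obtain ⟨z, rfl⟩ := ZMod.intCast_surjective z
        rw [map_intCast, ZMod.intCast_zmod_eq_zero_iff_dvd] at h2
        obtain ⟨w, rfl⟩ := h2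
        exact ⟨(w : ZMod (p^k)), by push_cast; rfl⟩
      obtain ⟨q, hq⟩ := h1
      refine ⟨Ideal.Quotient.mk _ q, ?_⟩
      rw [← map_nsmul, Ideal.Quotient.eq, Ideal.mem_span_singleton]
      refine ⟨h', ?_⟩
      have : p • q = C (p : ZMod (p^k)) * q := by simp
      rw [this, ← hq]; ring
    · rintro ⟨y, hy⟩
      obtain ⟨y, rfl⟩ := Ideal.Quotient.mk_surjective y
      rw [← map_nsmul, Ideal.Quotient.eq, Ideal.mem_span_singleton] at hy
      have := Polynomial.map_dvd c hy
      simpa using this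

theorem isUnit_of_modp {G K : Type} [CommRing G] [Field K] (p N : ℕ) (hN : (p : G) ^ N = 0)
    (π : G →+* K) (hs : Function.Surjective π) (hker : ∀ x, π x = 0 ↔ ∃ y, x = p • y)
    (u : G) (hu : π u ≠ 0) : IsUnit u := by
  obtain ⟨v, hv⟩ := hs (π u)⁻¹
  have h1 : π (u * v - 1) = 0 := by
    rw [map_sub, map_mul, hv, mul_inv_cancel₀ hu, map_one, sub_self]
  obtain ⟨z, hz⟩ := (hker _).1 h1
  have hnil : IsNilpotent (u * v - 1) := ⟨N, by rw [hz, nsmul_eq_mul, mul_pow, hN, zero_mul]⟩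
  have : IsUnit (u * v) := by
    have := hnil.isUnit_one_add
    simpa using this
  exact isUnit_of_mul_isUnit_left this

theorem exists_pow_mul_unit {G K : Type} [CommRing G] [Field K] (p k : ℕ) (hN : (p : G) ^ k = 0)
    (π : G →+* K) (hs : Function.Surjective π) (hker : ∀ x, π x = 0 ↔ ∃ y, x = p • y)
    (x : G) (hx : x ≠ 0) : ∃ i, i < k ∧ ∃ u, IsUnit u ∧ x = (p : G) ^ i * u := by
  by_contra! hcon
  have key : ∀ i, i ≤ k → ∃ u, x = (p : G)^i * u := by
    intro i
    induction i with
    | zero => intro _; exact ⟨x, by simp⟩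
    | succ i ih =>
      intro hi
      obtain ⟨u, hu⟩ := ih (by omega)
      by_cases h : π u = 0
      · obtain ⟨y, rfl⟩ := (hker _).1 h
        exact ⟨y, by rw [hu, pow_succ, nsmul_eq_mul, mul_assoc]⟩
      · exact absurd hu (hcon i (by omega) u (isUnit_of_modp p k hN π hs hker u h))
  obtain ⟨u, hu⟩ := key k le_rfl
  exact hx (by rw [hu, hN, zero_mul])

theorem gr_iso (p N : ℕ) (hp : p.Prime) (R F : Type) [Ring R] [Finite R] [Field F]
    (hN : (p : R) ^ N = 0) (φ : R →+* F) (hs : Function.Surjective φ)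
    (hker : ∀ x, φ x = 0 ↔ ∃ y, x = p • y) :
    ∃ (k : ℕ) (hk : 0 < k) (f : (ZMod (p^k))[X]), f.Monic ∧ 0 < f.natDegree ∧
      Irreducible (f.map (ZMod.castHom (dvd_pow_self p hk.ne') (ZMod p))) ∧
      Nonempty (R ≃+* ((ZMod (p^k))[X] ⧸ Ideal.span {f})) := by
  have : Fact p.Prime := ⟨hp⟩
  have hFfin : Finite F := Finite.of_surjective φ hs
  have hRnt : Nontrivial R := φ.domain_nontrivial
  obtain ⟨c, hc⟩ := CharP.exists R
  have hdvd : c ∣ p ^ N := by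
    rw [← CharP.cast_eq_zero_iff R c]; push_cast; exact hN
  obtain ⟨k, -, rfl⟩ := (Nat.dvd_prime_pow hp).1 hdvd
  have hk : 0 < k := by
    rcases Nat.eq_zero_or_pos k with rfl | h
    · exact absurd (by simp) (CharP.char_ne_one R (p^0))
    · exact h
  have hpF : (p : F) = 0 := by
    have : φ (p : R) = 0 := (hker _).2 ⟨1, by simp⟩
    simpa using this
  have hFp : CharP F p := (CharP.charP_iff_prime_eq_zero hp).2 hpF
  let _ : Algebra (ZMod p) F := ZMod.algebra F p
  set c := ZMod.castHom (dvd_pow_self p hk.ne') (ZMod p) with hcdef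
  have hcs : Function.Surjective c := ZMod.castHom_surjective _
  set ι : ZMod (p^k) →+* R := ZMod.castHom dvd_rfl R with hι
  have hcomp : φ.comp ι = (algebraMap (ZMod p) F).comp c := Subsingleton.elim _ _
  obtain ⟨g, hg⟩ := IsCyclic.exists_monoid_generator (α := Fˣ)
  obtain ⟨a, ha⟩ := hs (g : F)
  have hint : IsIntegral (ZMod p) (g : F) := Algebra.IsIntegral.isIntegral _
  set h := minpoly (ZMod p) (g : F) with hh
  have hmon : h.Monic := minpoly.monic hint
  have hirr : Irreducible h := minpoly.irreducible hint
  have hmemlift : ∀ q : (ZMod p)[X], q ∈ lifts c := fun q =>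
    (mem_lifts _).2 (Polynomial.map_surjective c hcs q)
  -- evaluation
  let ev : (ZMod (p^k))[X] →+* R := Polynomial.eval₂RingHom' ι a (fun x => by
    obtain ⟨z, rfl⟩ := ZMod.intCast_surjective x
    rw [map_intCast]; exact Int.cast_commute z a)
  have hev : ∀ q, φ (ev q) = aeval (g : F) (q.map c) := by
    intro q
    change φ (eval₂ ι a q) = _
    rw [Polynomial.hom_eval₂, hcomp, ha, aeval_def, eval₂_map]
  have hstep : ∀ x : R, ∃ q : (ZMod (p^k))[X], q.degree < h.degree ∧ ∃ y, x = ev q + p • y := by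
    intro x
    have h1 : ∃ q : (ZMod p)[X], q.degree < h.degree ∧ aeval (g : F) q = φ x := by
      have : ∃ q : (ZMod p)[X], aeval (g : F) q = φ x := by
        by_cases hx : φ x = 0
        · exact ⟨0, by simp [hx]⟩
        · obtain ⟨n, hn⟩ := hg (Units.mk0 _ hx)
          refine ⟨X^n, ?_⟩
          have := congrArg Units.val hn
          simpa using this
      obtain ⟨q, hq⟩ := this
      exact ⟨q %ₘ h, degree_modByMonic_lt _ hmon, by
        rw [← hq, hh, minpoly.aeval_modByMonic_minpoly]⟩
    obtain ⟨q, hq1, hq2⟩ := h1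
    obtain ⟨q', rfl, hd⟩ := exists_degree_eq_of_mem_lifts (hmemlift q)
    refine ⟨q', hd ▸ hq1, ?_⟩
    obtain ⟨y, hy⟩ := (hker (x - ev q')).1 (by rw [map_sub, hev, hq2, sub_self])
    exact ⟨y, by rw [← hy]; abel⟩
  have hiter : ∀ j : ℕ, ∀ x : R, ∃ q : (ZMod (p^k))[X], q.degree < h.degree ∧
      ∃ y, x = ev q + p^j • y := by
    intro j
    induction j with
    | zero => 
      intro x
      refine ⟨0, ?_, x, by simp⟩
      rw [degree_zero]; exact bot_lt_iff_ne_bot.2 (by rw [Ne, degree_eq_bot]; exact hmon.ne_zero)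
    | succ j ih =>
      intro x
      obtain ⟨q, hq, y, hy⟩ := ih x
      obtain ⟨q', hq', y', hy'⟩ := hstep y
      refine ⟨q + p^j • q', ?_, y', ?_⟩
      · refine (degree_add_le _ _).trans_lt (max_lt hq ?_)
        exact (degree_smul_le _ _).trans_lt hq'
      · rw [hy, hy', map_add, map_nsmul, smul_add, pow_succ, mul_smul, add_assoc]
  have hsur : ∀ x : R, ∃ q : (ZMod (p^k))[X], q.degree < h.degree ∧ ev q = x := by
    intro x
    obtain ⟨q, hq, y, hy⟩ := hiter N x
    refine ⟨q, hq, ?_⟩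
    rw [hy, nsmul_eq_mul]; push_cast; rw [hN, zero_mul, add_zero]
  obtain ⟨H, hHm, hHd, hHmon⟩ := lifts_and_degree_eq_and_monic (hmemlift h) hmon
  obtain ⟨y, hy⟩ := (hker (ev H)).1 (by rw [hev, hHm, hh, minpoly.aeval])
  obtain ⟨q, hq, hqy⟩ := hsur y
  have hpq : (p • q).degree < H.degree := by
    rw [hHd]; exact (degree_smul_le _ _).trans_lt hq
  set f := H - p • q with hf
  have hfmon : f.Monic := hHmon.sub_of_left hpq
  have hfmap : f.map c = h := by
    rw [hf, Polynomial.map_sub, hHm]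
    simp
  have hfev : ev f = 0 := by rw [hf, map_sub, map_nsmul, hqy, hy, sub_self]
  have hfirr : Irreducible (f.map c) := by rw [hfmap]; exact hirr
  refine ⟨k, hk, f, hfmon, ?_, hfirr, ?_⟩
  · have : f.natDegree = h.natDegree := by rw [← hfmap, hfmon.natDegree_map]
    rw [this]; exact minpoly.natDegree_pos hint
  obtain ⟨π, hπs, hπk⟩ := gr_map p k hk f
  have : Fact (Irreducible (f.map c)) := ⟨hfirr⟩
  have : (Ideal.span {f.map c}).IsMaximal := AdjoinRoot.span_maximal_of_irreducible
  let _ : Field ((ZMod p)[X] ⧸ Ideal.span {f.map c}) := Ideal.Quotient.field _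
  let θ : ((ZMod (p^k))[X] ⧸ Ideal.span {f}) →+* R := Ideal.Quotient.lift _ ev (by
    intro b hb
    obtain ⟨d, rfl⟩ := Ideal.mem_span_singleton.1 hb
    rw [map_mul, hfev, zero_mul])
  refine ⟨(RingEquiv.ofBijective θ ⟨?_, ?_⟩).symm⟩
  · rw [injective_iff_map_eq_zero]
    intro x hx
    by_contra hx0
    have hpG : (p : (ZMod (p^k))[X] ⧸ Ideal.span {f})^k = 0 := by
      have h0 : ((p^k : ℕ) : (ZMod (p^k))[X]) = 0 := by
        rw [← C_eq_natCast, ZMod.natCast_self, C_0]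
      have := congrArg (Ideal.Quotient.mk (Ideal.span {f})) h0
      rw [map_natCast, map_zero] at this
      exact_mod_cast this
    obtain ⟨i, hi, u, hu, rfl⟩ := exists_pow_mul_unit p k hpG π hπs hπk x hx0
    rw [map_mul, (hu.map θ).mul_left_eq_zero, map_pow, map_natCast] at hx
    have : p ^ k ∣ p ^ i := by
      rw [← CharP.cast_eq_zero_iff R (p^k)]; push_cast; exact hx
    have := (Nat.pow_dvd_pow_iff_le_right hp.one_lt).1 this
    omega
  · intro x
    obtain ⟨q, -, hq⟩ := hsur x
    exact ⟨Ideal.Quotient.mk _ q, hq⟩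

theorem matrix_units {n : ℕ} [NeZero n] {S F : Type} [Ring S] [Field F]
    (φ : S →+* Matrix (Fin n) (Fin n) F) (hs : Function.Surjective φ)
    (hnil : ∀ x ∈ RingHom.ker φ, IsNilpotent x) :
    ∃ E : Fin n → Fin n → S, (∀ i j k l, E i j * E k l = if j = k then E i l else 0) ∧
      ∑ i, E i i = 1 ∧ ∀ i j, φ (E i j) = Matrix.single i j 1 := by
  have h1 : CompleteOrthogonalIdempotents
      (fun i : Fin n => (Matrix.single i i 1 : Matrix (Fin n) (Fin n) F)) :=
    { idem := fun i => by simp [IsIdempotentElem]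
      ortho := fun i j hij => by
        change Matrix.single i i 1 * Matrix.single j j 1 = 0
        simp [hij]
      complete := by
        ext a b
        rw [Matrix.sum_apply]
        simp [Matrix.single_apply, Matrix.one_apply, ite_and]  }
  obtain ⟨e, he, hφe⟩ := CompleteOrthogonalIdempotents.lift_of_isNilpotent_ker φ hnil h1
    (fun i => hs _)
  replace hφe : ∀ i, φ (e i) = Matrix.single i i 1 := fun i => congrFun hφe i
  have hid : ∀ i, e i * e i = e i := fun i => he.idem i
  have hor : ∀ i j, i ≠ j → e i * e j = 0 := fun i j h => he.ortho h
  choose a0 ha0 using fun i => hs (Matrix.single (0 : Fin n) i 1)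
  choose b0 hb0 using fun i => hs (Matrix.single i (0 : Fin n) 1)
  have key : ∀ i, ∃ a b : S, e 0 * a = a ∧ a * e i = a ∧ e i * b = b ∧ b * e 0 = b ∧
      a * b = e 0 ∧ b * a = e i ∧ φ a = Matrix.single 0 i 1 ∧ φ b = Matrix.single i 0 1 := by
    intro i
    obtain ⟨a1, ha1⟩ : ∃ a1, a1 = e 0 * a0 i * e i := ⟨_, rfl⟩
    obtain ⟨b, hb⟩ : ∃ b, b = e i * b0 i * e 0 := ⟨_, rfl⟩
    have ea : e 0 * a1 = a1 := by rw [ha1, ← mul_assoc, ← mul_assoc, hid]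
    have ae : a1 * e i = a1 := by rw [ha1, mul_assoc, hid]
    have eb : e i * b = b := by rw [hb, ← mul_assoc, ← mul_assoc, hid]
    have be : b * e 0 = b := by rw [hb, mul_assoc, hid]
    have φa1 : φ a1 = Matrix.single 0 i 1 := by simp [ha1, hφe, ha0]
    have φb : φ b = Matrix.single i 0 1 := by simp [hb, hφe, hb0]
    obtain ⟨w, hw⟩ : ∃ w, w = a1 * b + (1 - e 0) := ⟨_, rfl⟩
    have φw : φ w = 1 := by simp [hw, φa1, φb, hφe]
    have uw : IsUnit w := by
      have : IsNilpotent (w - 1) := hnil _ (by rw [RingHom.mem_ker, map_sub, φw, map_one, sub_self])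
      simpa using this.isUnit_one_add
    obtain ⟨W, rfl⟩ := uw
    have hWe : (W : S) * e 0 = a1 * b := by
      rw [hw, add_mul, mul_assoc, be, sub_mul, hid, one_mul, sub_self, add_zero]
    have heW : e 0 * (W : S) = a1 * b := by
      rw [hw, mul_add, ← mul_assoc, ea, mul_sub, hid, mul_one, sub_self, add_zero]
    have hcomm : Commute (e 0) (W : S) := by rw [Commute, SemiconjBy, heW, hWe]
    have hcomm' : e 0 * (↑W⁻¹ : S) = ↑W⁻¹ * e 0 := hcomm.units_inv_right
    have φW : φ (↑W⁻¹ : S) = 1 := by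
      have : φ (↑W⁻¹ * ↑W : S) = 1 := by rw [Units.inv_mul, map_one]
      rwa [map_mul, φw, mul_one] at this
    have hab : (↑W⁻¹ * a1) * b = e 0 := by
      rw [mul_assoc, ← hWe, Units.inv_mul_cancel_left]
    have φa : φ (↑W⁻¹ * a1) = Matrix.single 0 i 1 := by rw [map_mul, φW, one_mul, φa1]
    have hea : e 0 * (↑W⁻¹ * a1) = ↑W⁻¹ * a1 := by rw [← mul_assoc, hcomm', mul_assoc, ea]
    refine ⟨↑W⁻¹ * a1, b, hea, ?_, eb, be, hab, ?_, φa, φb⟩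
    · rw [mul_assoc, ae]
    · symm
      apply eq_of_isNilpotent_sub_of_isIdempotentElem_of_commute (hid i)
      · change b * (↑W⁻¹ * a1) * (b * (↑W⁻¹ * a1)) = b * (↑W⁻¹ * a1)
        rw [mul_assoc b, ← mul_assoc (↑W⁻¹ * a1) b, hab, hea]
      · apply hnil
        rw [RingHom.mem_ker, map_sub, map_mul, φa, φb, hφe]
        simp
      · rw [Commute, SemiconjBy, ← mul_assoc, eb]
        simp only [mul_assoc, ae]
  choose a b h using key
  refine ⟨fun i j => b i * a j, ?_, ?_, ?_⟩
  · intro i j k l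
    obtain ⟨h1, h2, h3, h4, h5, h6, h7, h8⟩ := h j
    have hl := (h l).1
    have hk := (h k).2.2.1
    split_ifs with hjk
    · subst hjk
      rw [mul_assoc, ← mul_assoc (a j), h5, hl]
    · rw [mul_assoc, ← mul_assoc (a j), ← h2, ← hk, mul_assoc (a j), ← mul_assoc (e j), hor _ _ hjk]
      simp
  · rw [← he.complete]
    exact Finset.sum_congr rfl fun i _ => (h i).2.2.2.2.2.1
  · intro i j
    rw [map_mul, (h i).2.2.2.2.2.2.2, (h j).2.2.2.2.2.2.1]
    simp

theorem matrix_iso (p N n : ℕ) [NeZero n] (S F : Type) [Ring S] [Finite S] [Field F]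
    (hN : (p : S) ^ N = 0)
    (φ : S →+* Matrix (Fin n) (Fin n) F) (hs : Function.Surjective φ)
    (hker : ∀ x, φ x = 0 ↔ ∃ y, x = p • y) :
    ∃ (R : Type) (_ : Ring R) (_ : Finite R) (ψ : R →+* F), (p : R) ^ N = 0 ∧
      Function.Surjective ψ ∧ (∀ x, ψ x = 0 ↔ ∃ y, x = p • y) ∧
      Nonempty (S ≃+* Matrix (Fin n) (Fin n) R) := by
  obtain ⟨E, hE, hE1, hφE⟩ := matrix_units φ hs (by
    intro x hx
    obtain ⟨y, rfl⟩ := (hker x).1 hx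
    refine ⟨N, ?_⟩
    rw [nsmul_eq_mul, (Nat.cast_commute p y).mul_pow, hN, zero_mul])
  let R : Subring S := Subring.centralizer (Set.range fun ij : Fin n × Fin n => E ij.1 ij.2)
  have hR : ∀ x : S, x ∈ R ↔ ∀ i j, E i j * x = x * E i j := by
    intro x
    simp only [R, Subring.mem_centralizer_iff, Set.forall_mem_range, Prod.forall]
  have hmem : ∀ (x : S) i j, ∑ k, E k i * x * E j k ∈ R := by
    intro x i j
    rw [hR]
    intro a b
    rw [Finset.mul_sum, Finset.sum_mul]
    simp only [← mul_assoc, hE]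
    simp only [mul_assoc, hE]
    simp
  have hsc : ∀ r : R, φ r = Matrix.scalar (Fin n) (φ r 0 0) := by
    intro r
    have : φ r ∈ Set.range (Matrix.scalar (Fin n)) := by
      apply Matrix.mem_range_scalar_of_commute_single
      intro i j _
      rw [← hφE, Commute, SemiconjBy, ← map_mul, ← map_mul, (hR _).1 r.2]
    obtain ⟨c, hc⟩ := this
    rw [← hc]; simp
  let ψ : R →+* F :=
    { toFun := fun r => φ r 0 0
      map_one' := by simp
      map_zero' := by simp
      map_add' := by intro x y; simp
      map_mul' := by
        intro x y
        rw [Subring.coe_mul, map_mul, hsc x, hsc y]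
        simp }
  have hψ : ∀ r : R, φ r = Matrix.scalar (Fin n) (ψ r) := hsc
  have hrec : ∀ r : R, ∑ k, E k 0 * (r : S) * E 0 k = r := by
    intro r
    have : ∀ k, E k 0 * (r : S) * E 0 k = r * E k k := by
      intro k
      rw [(hR _).1 r.2, mul_assoc, hE, if_pos rfl]
    simp only [this]
    rw [← Finset.mul_sum, hE1, mul_one]
  refine ⟨R, inferInstance, inferInstance, ψ, ?_, ?_, ?_, ?_⟩
  · apply Subtype.ext; push_cast; exact hN
  · intro c
    obtain ⟨s, hsc⟩ := hs (Matrix.scalar (Fin n) c)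
    refine ⟨⟨∑ k, E k 0 * s * E 0 k, hmem s 0 0⟩, ?_⟩
    change φ (∑ k, E k 0 * s * E 0 k) 0 0 = c
    rw [map_sum, Matrix.sum_apply, Finset.sum_eq_single 0]
    · simp only [map_mul, hφE, hsc]
      simp 
    · intro k _ hk
      simp only [map_mul, hφE, hsc]
      simp [hk]
    · simp
  · intro x
    constructor
    · intro hx
      obtain ⟨y, hy⟩ := (hker x).1 (by rw [hψ, hx, map_zero])
      refine ⟨⟨∑ k, E k 0 * y * E 0 k, hmem y 0 0⟩, ?_⟩
      apply Subtype.ext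
      rw [← hrec x, hy]
      change _ = p • ∑ k, E k 0 * y * E 0 k
      simp only [Finset.smul_sum, mul_smul_comm, smul_mul_assoc]
    · rintro ⟨y, rfl⟩
      have : φ (p • y : S) = 0 := (hker _).2 ⟨y, rfl⟩
      change φ ((p • y : R) : S) 0 0 = 0
      push_cast
      rw [this]; rfl
  · let μ : Matrix (Fin n) (Fin n) R → S := fun A => ∑ i, ∑ j, (A i j : S) * E i j
    refine ⟨RingEquiv.symm
      { toFun := μ
        invFun := fun x => Matrix.of fun i j => ⟨∑ k, E k i * x * E j k, hmem x i j⟩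
        left_inv := ?_
        right_inv := ?_
        map_mul' := ?_
        map_add' := ?_ }⟩
    · intro A
      ext i j
      change ∑ k, E k i * (∑ a, ∑ b, (A a b : S) * E a b) * E j k = _
      have : ∀ k, E k i * (∑ a, ∑ b, (A a b : S) * E a b) * E j k = A i j * E k k := by
        intro k
        simp only [Finset.mul_sum, Finset.sum_mul, ← mul_assoc, (hR _).1 (A _ _).2]
        simp only [mul_assoc, hE]
        simp [hE]
      simp only [this]
      rw [← Finset.mul_sum, hE1, mul_one]
    · intro x
      change ∑ i, ∑ j, (∑ k, E k i * x * E j k) * E i j = x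
      simp only [Finset.sum_mul, mul_assoc, hE]
      simp only [mul_ite, mul_zero, Finset.sum_ite_eq', Finset.mem_univ, if_true]
      simp only [← Finset.mul_sum, hE1, mul_one, ← Finset.sum_mul, one_mul]
    · intro A B
      change ∑ i, ∑ j, ((A * B) i j : S) * E i j = (∑ i, ∑ j, (A i j : S) * E i j) * (∑ i, ∑ j, (B i j : S) * E i j)
      have h1 : ∀ i j k l, (A i j : S) * E i j * ((B k l : S) * E k l) =
          if j = k then (A i j : S) * B k l * E i l else 0 := by
        intro i j k l
        rw [mul_assoc, ← mul_assoc (E i j), (hR _).1 (B k l).2, mul_assoc, hE]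
        split_ifs <;> simp [mul_assoc]
      simp only [Finset.sum_mul, Finset.mul_sum, h1, Matrix.mul_apply]
      push_cast
      simp only [Finset.sum_mul]
      simp only [Finset.sum_ite_eq', Finset.mem_univ, if_true]
      rw [Finset.sum_comm]
      conv_lhs => enter [2, l]; rw [Finset.sum_comm]
      rw [Finset.sum_comm]
    · intro A B
      simp [μ, add_mul, Finset.sum_add_distrib]

theorem corner_zero {S T : Type} [Ring S] [Ring T] (p N : ℕ) (hN : (p : S) ^ N = 0)
    (φ : S →+* T) (hker : ∀ x, φ x = 0 ↔ ∃ y, x = p • y) (g h : S) (hg : g * g = g)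
    (hh : h * h = h) (h0 : ∀ x, φ (g * x * h) = 0) (x : S) : g * x * h = 0 := by
  have key : ∀ j : ℕ, ∃ y, g * x * h = p ^ j • (g * y * h) := by
    intro j
    induction j with
    | zero => exact ⟨x, by simp⟩
    | succ j ih =>
      obtain ⟨y, hy⟩ := ih
      obtain ⟨z, hz⟩ := (hker _).1 (h0 y)
      refine ⟨z, ?_⟩
      have h1 : g * y * h = g * (g * y * h) * h := by
        rw [← mul_assoc, ← mul_assoc, hg, mul_assoc _ h h, hh]
      rw [hy, h1, hz, mul_smul_comm, smul_mul_assoc, pow_succ, mul_smul]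
  obtain ⟨y, hy⟩ := key N
  rw [hy, nsmul_eq_mul]; push_cast; rw [hN, zero_mul]

theorem blocks (p N t : ℕ) (hp : p.Prime) (S : Type) [Ring S] [Finite S] (hN : (p : S) ^ N = 0)
    (d : Fin t → ℕ) [∀ i, NeZero (d i)] (F : Fin t → Type) [∀ i, Field (F i)]
    (φ : S →+* ∀ i, Matrix (Fin (d i)) (Fin (d i)) (F i)) (hs : Function.Surjective φ)
    (hker : ∀ x, φ x = 0 ↔ ∃ y, x = p • y) :
    ∃ (C : Fin t → Type) (_ : ∀ i, Ring (C i)), Nonempty (S ≃+* ∀ i, C i) ∧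
     ∀ i, ∃ (k : ℕ) (hk : 0 < k) (f : (ZMod (p^k))[X]), f.Monic ∧ 0 < f.natDegree ∧
      Irreducible (f.map (ZMod.castHom (dvd_pow_self p hk.ne') (ZMod p))) ∧
      Nonempty (C i ≃+* Matrix (Fin (d i)) (Fin (d i)) ((ZMod (p^k))[X] ⧸ Ideal.span {f})) := by
  have h1 := CompleteOrthogonalIdempotents.single (fun i => Matrix (Fin (d i)) (Fin (d i)) (F i))
  obtain ⟨e, he, hφe⟩ := CompleteOrthogonalIdempotents.lift_of_isNilpotent_ker φ (by
    intro x hx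
    obtain ⟨y, rfl⟩ := (hker x).1 hx
    refine ⟨N, ?_⟩
    rw [nsmul_eq_mul, (Nat.cast_commute p y).mul_pow, hN, zero_mul]) h1 (fun i => hs _)
  replace hφe : ∀ i, φ (e i) = Pi.single i 1 := fun i => congrFun hφe i
  have hid : ∀ i, e i * e i = e i := fun i => he.idem i
  have hcen0 : ∀ i x, φ (e i) * φ x = φ x * φ (e i) := by
    intro i x
    rw [hφe]
    ext j : 1
    by_cases hj : j = i
    · subst hj; simp
    · simp [hj]
  have hcen : ∀ i x, e i * x = x * e i := by
    intro i x
    have hid' : (1 - e i) * (1 - e i) = 1 - e i := (he.idem i).one_sub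
    have a1 : e i * x * (1 - e i) = 0 := corner_zero p N hN φ hker _ _ (hid i) hid' (by
      intro y
      rw [map_mul, map_mul, hcen0, ← map_mul, ← map_mul, mul_assoc, mul_sub, hid]
      simp) x
    have a2 : (1 - e i) * x * e i = 0 := corner_zero p N hN φ hker _ _ hid' (hid i) (by
      intro y
      rw [mul_assoc, map_mul, map_mul, ← hcen0, ← map_mul, ← map_mul, ← mul_assoc, sub_mul, hid]
      simp) x
    rw [mul_sub, mul_one, sub_eq_zero] at a1
    rw [sub_mul, sub_mul, one_mul, sub_eq_zero] at a2
    rw [a1, a2]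
  have hc : ∀ i, IsMulCentral (e i) := fun i => Semigroup.mem_center_iff.mpr fun x => (hcen i x).symm
  refine ⟨fun i => (he.idem i).Corner, fun i => inferInstance,
    ⟨he.ringEquivOfIsMulCentral hc⟩, ?_⟩
  intro i
  let v : (he.idem i).Corner →+ S :=
    { toFun := fun x => x.1
      map_zero' := rfl
      map_add' := fun _ _ => rfl }
  have hv : Function.Injective v := Subtype.val_injective
  have hv1 : v 1 = e i := rfl
  have hvm : ∀ x y, v (x * y) = v x * v y := fun _ _ => rfl
  have hve : ∀ x, e i * v x * e i = v x := by
    intro x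
    have : v (1 * x * 1) = v x := by rw [one_mul, mul_one]
    rwa [hvm, hvm, hv1] at this
  have hfin : Finite (he.idem i).Corner := Finite.of_injective v hv
  let φi : (he.idem i).Corner →+* Matrix (Fin (d i)) (Fin (d i)) (F i) :=
    { toFun := fun x => φ (v x) i
      map_one' := by rw [hv1, hφe]; simp
      map_zero' := by simp
      map_mul' := by intro x y; rw [hvm, map_mul]; rfl
      map_add' := by intro x y; rw [map_add, map_add]; rfl }
  have hφi : ∀ x, φi x = φ (v x) i := fun _ => rfl
  obtain ⟨R, _, _, ψ, hRN, hψs, hψk, ⟨E⟩⟩ := matrix_iso p N (d i) (he.idem i).Corner (F i) (by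
      have : ((p ^ N : ℕ) : (he.idem i).Corner) = 0 := by
        apply hv
        rw [map_zero, ← nsmul_one, map_nsmul, nsmul_eq_mul]
        push_cast
        rw [hN, zero_mul]
      exact_mod_cast this) φi (by
      intro c
      obtain ⟨s, hs'⟩ := hs (Pi.single i c)
      refine ⟨⟨e i * s * e i, s, rfl⟩, ?_⟩
      change φ (e i * s * e i) i = c
      rw [map_mul, map_mul, hφe, hs']
      simp) (by
      intro x
      constructor
      · intro hx
        obtain ⟨y, hy⟩ := (hker (v x)).1 (by
          rw [← hve, map_mul, map_mul, hφe]
          ext j : 1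
          by_cases hj : j = i
          · subst hj; rw [hφi] at hx; simp [hx]
          · simp [hj])
        obtain ⟨z, hz⟩ : ∃ z, v z = e i * y * e i := ⟨⟨e i * y * e i, y, rfl⟩, rfl⟩
        refine ⟨z, ?_⟩
        apply hv
        rw [map_nsmul, hz, ← hve, hy, mul_smul_comm, smul_mul_assoc]
      · rintro ⟨y, rfl⟩
        rw [hφi, map_nsmul, (hker _).2 ⟨_, rfl⟩]
        rfl)
  obtain ⟨k, hk, f, h2, h3, h4, ⟨G⟩⟩ := gr_iso p N hp R (F i) hRN ψ hψs hψk
  exact ⟨k, hk, f, h2, h3, h4, ⟨E.trans G.mapMatrix⟩⟩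

theorem stmt_7 (p m : ℕ) (hp : p.Prime) (S : Type) [Ring S] [Fintype S]
    (hcard : Fintype.card S = p ^ m) :
    (∃ (t : ℕ) (msz ksz rsz : Fin t → ℕ) (hk : ∀ i, 0 < ksz i)
        (f : ∀ i, Polynomial (ZMod (p ^ ksz i))),
      (∀ i, 0 < msz i) ∧ (∀ i, 0 < rsz i) ∧
      (∀ i, (f i).Monic) ∧ (∀ i, (f i).natDegree = rsz i) ∧
      (∀ i, Irreducible
        ((f i).map (ZMod.castHom (dvd_pow_self p (hk i).ne') (ZMod p)))) ∧
      Nonempty (S ≃+* ∀ i : Fin t, Matrix (Fin (msz i)) (Fin (msz i))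
        (Polynomial (ZMod (p ^ ksz i)) ⧸ Ideal.span {f i})))
    ↔ (((⊥ : Ideal S).jacobson : Set S) = {x : S | ∃ s : S, x = p • s}) := by
  have hN : (p : S) ^ m = 0 := by
    have := Nat.cast_card_eq_zero S
    rw [hcard] at this
    exact_mod_cast this
  constructor
  · rintro ⟨t, n, k, r, hk, f, hn, hr, hmon, hdeg, hirr, ⟨e⟩⟩
    choose π hπs hπk using fun i => gr_map p (k i) (hk i) (f i)
    have hmax : ∀ i, (Ideal.span {(f i).map (ZMod.castHom (dvd_pow_self p (hk i).ne')
        (ZMod p))}).IsMaximal := fun i =>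
      have : Fact p.Prime := ⟨hp⟩
      have := Fact.mk (hirr i)
      AdjoinRoot.span_maximal_of_irreducible
    let K : Fin t → Type := fun i => (ZMod p)[X] ⧸ (Ideal.span {(f i).map (ZMod.castHom
      (dvd_pow_self p (hk i).ne') (ZMod p))})
    let _ : ∀ i, Field (K i) := fun i => Ideal.Quotient.field _
    let Ψ : S →+* ∀ i, Matrix (Fin (n i)) (Fin (n i)) (K i) :=
      RingHom.pi fun i => ((π i).mapMatrix.comp (Pi.evalRingHom _ i)).comp e.toRingHom
    have hΨ : ∀ x i a b, Ψ x i a b = π i (e x i a b) := fun _ _ _ _ => rfl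
    have hΨs : Function.Surjective Ψ := by
      intro y
      choose g hg using fun i a b => hπs i (y i a b)
      refine ⟨e.symm fun i => Matrix.of (g i), ?_⟩
      ext i a b
      rw [hΨ, RingEquiv.apply_symm_apply]
      exact hg i a b
    ext x
    simp only [SetLike.mem_coe, Set.mem_ofPred_eq]
    constructor
    · intro hx
      rw [Ideal.jacobson_bot] at hx
      have : RingHomSurjective Ψ := ⟨hΨs⟩
      have h1 := Ring.le_comap_jacobson Ψ hx
      rw [Ideal.mem_comap, IsSemisimpleRing.jacobson_eq_bot, Ideal.mem_bot] at h1
      have h2 : ∀ i a b, ∃ y, e x i a b = p • y := by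
        intro i a b
        rw [← hπk, ← hΨ, h1]; rfl
      choose y hy using h2
      refine ⟨e.symm fun i => Matrix.of (y i), ?_⟩
      apply e.injective
      rw [map_nsmul, RingEquiv.apply_symm_apply]
      ext i a b
      exact hy i a b
    · rintro ⟨s, rfl⟩
      rw [Ideal.mem_jacobson_iff]
      intro y
      have hnil : IsNilpotent (y * (p • s)) := ⟨m, by
        rw [mul_smul_comm, nsmul_eq_mul, (Nat.cast_commute p (y * s)).mul_pow, hN, zero_mul]⟩
      obtain ⟨u, hu⟩ := hnil.isUnit_one_add
      refine ⟨↑u⁻¹, ?_⟩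
      rw [Ideal.mem_bot, sub_eq_zero, mul_assoc]
      have : (↑u⁻¹ : S) * u = 1 := u.inv_mul
      rw [hu, mul_add, mul_one, add_comm] at this
      exact this
  · intro hJ
    rw [Ideal.jacobson_bot] at hJ
    have hJ' : ∀ x, x ∈ Ring.jacobson S ↔ ∃ s, x = p • s := fun x => by
      rw [← SetLike.mem_coe, hJ]; rfl
    obtain ⟨t, D, d, _, hd, ⟨E⟩⟩ :=
      IsSemisimpleRing.exists_ringEquiv_pi_matrix_divisionRing (S ⧸ Ring.jacobson S)
    have hDfin : ∀ i, Finite (D i) := by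
      intro i
      apply Finite.of_surjective (fun x => E (Ideal.Quotient.mk _ x) i 0 0 : S → D i)
      intro c
      obtain ⟨x, hx⟩ := Ideal.Quotient.mk_surjective (E.symm fun j => Matrix.of fun _ _ =>
        if h : j = i then h ▸ c else 0)
      refine ⟨x, ?_⟩
      simp [hx]
    let _ : ∀ i, Field (D i) := fun i => littleWedderburn (D i)
    obtain ⟨C, _, ⟨G⟩, hC⟩ := blocks p m t hp S hN d D
      (E.toRingHom.comp (Ideal.Quotient.mk (Ring.jacobson S)))
      (E.surjective.comp Ideal.Quotient.mk_surjective) (by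
        intro x
        rw [← hJ', ← Ideal.Quotient.eq_zero_iff_mem]
        exact E.map_eq_zero_iff)
    choose k hk f hmon hdeg hirr hiso using hC
    exact ⟨t, d, k, fun i => (f i).natDegree, hk, f, fun i => Nat.pos_of_ne_zero (hd i).out, hdeg,
      hmon, fun i => rfl, hirr, ⟨G.trans (RingEquiv.piCongrRight fun i => (hiso i).some)⟩⟩
end
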